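/- arXiv:0901.4030 — 2 statements merged into one kernel-verified Lean document; each statement's English description precedes it below -/
import Mathlib

section
/- Let f be a complex polynomial of degree n ≥ 1. Then the set R(f) = {z ∈ ℂ : Re(f(z)) = 0} is connected (i.e., the circular forest R(f) is a single tree) if and only if every critical value of f has real part equal to 0. Similarly, I(f) = {z ∈ ℂ : Im(f(z)) = 0} is connected if and only if every critical value of f has imaginary part equal to 0. -/
open Polynomial Set Filter Topology

/-- Lifts converge at boundary points. -/
lemma lift_tendsto (f : ℂ[X]) (hdeg : 0 < f.degree) (F : ℂ → ℂ)
    (hF : ContinuousOn F {w | 0 < w.re}) (hfF : ∀ w : ℂ, 0 < w.re → f.eval (F w) = w)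
    (b : ℂ) (hb : 0 ≤ b.re) : ∃ y, Tendsto F (𝓝[{w | 0 < w.re}] b) (𝓝 y) := by
  have hcl : b ∈ closure {w : ℂ | 0 < w.re} := by
    rw [Complex.closure_setOfPred_lt_re]; exact hb
  have : NeBot (𝓝[{w : ℂ | 0 < w.re}] b) := mem_closure_iff_nhdsWithin_neBot.mp hcl
  have hself : ∀ᶠ w in 𝓝[{w : ℂ | 0 < w.re}] b, 0 < w.re := self_mem_nhdsWithin
  have hK : IsCompact (f.eval ⁻¹' (Metric.closedBall b 1)) :=
    (f.isProperMap_eval hdeg).isCompact_preimage (isCompact_closedBall b 1)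
  have hev : ∀ᶠ w in 𝓝[{w : ℂ | 0 < w.re}] b, F w ∈ f.eval ⁻¹' (Metric.closedBall b 1) := by
    have h1 : ∀ᶠ w in 𝓝[{w : ℂ | 0 < w.re}] b, w ∈ Metric.closedBall b 1 :=
      nhdsWithin_le_nhds (Metric.closedBall_mem_nhds b one_pos)
    filter_upwards [h1, hself] with w h1 h2
    simpa [hfF w h2] using h1
  obtain ⟨p, -, hp⟩ := hK.exists_mapClusterPt (f := 𝓝[{w : ℂ | 0 < w.re}] b) (u := F)
    (by rw [le_principal_iff]; exact hev)
  refine ⟨p, ?_⟩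
  -- finite fibre
  have hfin : (f.eval ⁻¹' {b}).Finite := by
    have ne : f ≠ C b := by
      rintro rfl
      exact absurd hdeg (not_lt.mpr degree_C_le)
    simpa only [preimage_eval_singleton ne] using rootSet_finite ..
  rw [Metric.tendsto_nhds]
  intro ε hε
  -- radius with no other fibre points
  obtain ⟨r, hr, hrε, hrf⟩ : ∃ r, 0 < r ∧ r ≤ ε ∧ ∀ z ∈ Metric.sphere p r, f.eval z ≠ b := by
    have hfin' : ((fun z => dist z p) '' (f.eval ⁻¹' {b})).Finite := hfin.image _
    have hinf : (Ioo 0 ε \ ((fun z => dist z p) '' (f.eval ⁻¹' {b}))).Nonempty :=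
      ((Ioo_infinite hε).sdiff hfin').nonempty
    obtain ⟨r, hr, hr'⟩ := hinf
    refine ⟨r, hr.1, hr.2.le, fun z hz hzb => hr' ⟨z, hzb, ?_⟩⟩
    exact hz
  obtain ⟨δ, hδ, hδs⟩ : ∃ δ > 0, ∀ z ∈ Metric.sphere p r, δ ≤ dist (f.eval z) b := by
    have hne : (Metric.sphere p r).Nonempty := NormedSpace.sphere_nonempty.mpr hr.le
    obtain ⟨z0, hz0, hmin⟩ := (isCompact_sphere p r).exists_isMinOn hne
      (f := fun z => dist (f.eval z) b) (by fun_prop)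
    exact ⟨_, dist_pos.mpr (hrf z0 hz0), fun z hz => hmin hz⟩
  set N : Set ℂ := {w : ℂ | 0 < w.re} ∩ Metric.ball b δ with hN
  have hNconv : IsPreconnected N :=
    ((convex_halfSpace_re_gt 0).inter (convex_ball b δ)).isPreconnected
  have hNmem : N ∈ 𝓝[{w : ℂ | 0 < w.re}] b :=
    inter_mem self_mem_nhdsWithin (nhdsWithin_le_nhds (Metric.ball_mem_nhds b hδ))
  have hNc : ContinuousOn (fun w => dist (F w) p) N :=
    (continuous_id.dist continuous_const).comp_continuousOn (hF.mono inter_subset_left)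
  have hfreq : ∃ᶠ w in 𝓝[{w : ℂ | 0 < w.re}] b, dist (F w) p < r :=
    hp.frequently (Metric.ball_mem_nhds p hr)
  obtain ⟨w0, hw0, hw0N⟩ := (hfreq.and_eventually hNmem).exists
  filter_upwards [hNmem] with w hw
  by_contra hcon
  push Not at hcon
  obtain ⟨w1, hw1, hw1r⟩ := hNconv.intermediate_value hw0N hw hNc
    (show r ∈ Icc _ _ from ⟨hw0.le, hrε.trans hcon⟩)
  have := hδs (F w1) hw1r
  rw [hfF w1 hw1.1] at this
  exact absurd hw1.2 (by simpa using this)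

/-- Unique lifting over the open half plane. -/
lemma exists_lift (f : ℂ[X]) (hc : ∀ ω, f.derivative.eval ω = 0 → (f.eval ω).re ≤ 0)
    (w0 z0 : ℂ) (hw0 : 0 < w0.re) (hz : f.eval z0 = w0) :
    ∃! F : C({w : ℂ // 0 < w.re}, ℂ), F ⟨w0, hw0⟩ = z0 ∧ ∀ w, f.eval (F w) = (w : ℂ) := by
  have hconv : Convex ℝ {w : ℂ | 0 < w.re} := convex_halfSpace_re_gt 0
  have : ContractibleSpace {w : ℂ // 0 < w.re} := hconv.contractibleSpace ⟨w0, hw0⟩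
  have : LocallyPathConnectedSpace {w : ℂ // 0 < w.re} :=
    (isOpen_lt continuous_const Complex.continuous_re).locallyPathConnectedSpace
  have := f.isCoveringMapOn_eval.existsUnique_continuousMap_lifts
    (A := {w : ℂ // 0 < w.re}) (⟨fun w => (w : ℂ), continuous_subtype_val⟩)
    (a₀ := ⟨w0, hw0⟩) (e₀ := z0) hz (by
      rintro ⟨w, hw⟩ ⟨ω, h1, h2⟩
      have := hc ω h1
      simp only [ContinuousMap.coe_mk] at h2
      rw [h2] at this
      linarith)
  simpa only [funext_iff, Function.comp_apply, ContinuousMap.coe_mk] using this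

lemma lift_unique (f : ℂ[X]) (hc : ∀ ω, f.derivative.eval ω = 0 → (f.eval ω).re ≤ 0)
    (F G : ℂ → ℂ) (hF : ContinuousOn F {w | 0 < w.re}) (hG : ContinuousOn G {w | 0 < w.re})
    (hfF : ∀ w : ℂ, 0 < w.re → f.eval (F w) = w) (hfG : ∀ w : ℂ, 0 < w.re → f.eval (G w) = w)
    (w0 : ℂ) (hw0 : 0 < w0.re) (h : F w0 = G w0) : ∀ w : ℂ, 0 < w.re → F w = G w := by
  obtain ⟨Φ, -, hu⟩ := exists_lift f hc w0 (F w0) hw0 (hfF w0 hw0)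
  have h1 := hu ⟨fun w => F w, hF.domRestrict⟩ ⟨rfl, fun w => hfF w w.2⟩
  have h2 := hu ⟨fun w => G w, hG.domRestrict⟩ ⟨h.symm, fun w => hfG w w.2⟩
  intro w hw
  have := congrArg (fun Φ : C({w : ℂ // 0 < w.re}, ℂ) => Φ ⟨w, hw⟩) (h1.trans h2.symm)
  exact this

lemma lift_extend (f : ℂ[X]) (hdeg : 0 < f.degree)
    (hc : ∀ ω, f.derivative.eval ω = 0 → (f.eval ω).re ≤ 0) (i : ℂ) (hi : f.eval i = 1) :
    ∃ F : ℂ → ℂ, ContinuousOn F {w | 0 ≤ w.re} ∧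
      (∀ w : ℂ, 0 ≤ w.re → f.eval (F w) = w) ∧ F 1 = i := by
  obtain ⟨Φ, ⟨hΦ1, hΦ2⟩, -⟩ := exists_lift f hc 1 i (by simp) hi
  classical
  let G : ℂ → ℂ := fun w => if h : 0 < w.re then Φ ⟨w, h⟩ else 0
  have hGv : ∀ (w : ℂ) (h : 0 < w.re), G w = Φ ⟨w, h⟩ := fun w h => dif_pos h
  have hG : ContinuousOn G {w | 0 < w.re} := by
    rw [continuousOn_iff_continuous_domRestrict]
    refine Φ.continuous.congr fun w => ?_
    exact (hGv w w.2).symm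
  have hfG : ∀ w : ℂ, 0 < w.re → f.eval (G w) = w := fun w h => by
    rw [hGv w h]; exact hΦ2 ⟨w, h⟩
  have hopen : IsOpen {w : ℂ | 0 < w.re} := isOpen_lt continuous_const Complex.continuous_re
  have hcl : {w : ℂ | 0 ≤ w.re} ⊆ closure {w : ℂ | 0 < w.re} := by
    rw [Complex.closure_setOfPred_lt_re]
  have hext : ContinuousOn (extendFrom {w | 0 < w.re} G) {w | 0 ≤ w.re} :=
    continuousOn_extendFrom hcl fun x hx => lift_tendsto f hdeg G hG hfG x hx
  have hagree : ∀ w : ℂ, 0 < w.re → extendFrom {w | 0 < w.re} G w = G w := fun w hw =>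
    extendFrom_eq (hcl (le_of_lt hw)) (hG w hw)
  refine ⟨_, hext, ?_, ?_⟩
  · have : EqOn (fun w => f.eval (extendFrom {w | 0 < w.re} G w)) (fun w => w) {w : ℂ | 0 ≤ w.re} := by
      refine EqOn.of_subset_closure (s := {w : ℂ | 0 < w.re}) ?_ (f.continuous.comp_continuousOn hext)
        continuousOn_id (fun w (hw : 0 < w.re) => hw.le) hcl
      intro w hw
      simp only [hagree w hw, hfG w hw]
    exact fun w hw => this hw
  · rw [hagree 1 (by simp), hGv 1 (by simp)]; exact hΦ1

lemma core (f : ℂ[X]) (hdeg : 0 < f.degree)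
    (hc : ∀ ω, f.derivative.eval ω = 0 → (f.eval ω).re ≤ 0) :
    ∃ (S : Finset ℂ) (g : ℂ → ℂ → ℂ), (∀ i ∈ S, ContinuousOn (g i) {w | 0 ≤ w.re}) ∧
      (∀ i ∈ S, ∀ w : ℂ, 0 ≤ w.re → f.eval (g i w) = w) ∧
      (∀ i ∈ S, ∀ j ∈ S, i ≠ j → ∀ w : ℂ, 0 < w.re → g i w ≠ g j w) ∧
      (∀ w : ℂ, 0 ≤ w.re → f - C w = C f.leadingCoeff * ∏ i ∈ S, (X - C (g i w))) := by
  classical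
  have hne : ∀ w, f - C w ≠ 0 := by
    intro w h
    rw [sub_eq_zero] at h
    rw [h] at hdeg
    exact absurd hdeg (not_lt.mpr degree_C_le)
  have hnd : ∀ w, (f - C w).natDegree = f.natDegree := fun w => natDegree_sub_C
  have hlc : ∀ w, (f - C w).leadingCoeff = f.leadingCoeff := fun w => by
    rw [leadingCoeff, hnd, coeff_sub, coeff_C_of_ne_zero (natDegree_pos_iff_degree_pos.mpr hdeg).ne',
      sub_zero]; rfl
  have hnodup : (f - C 1).roots.Nodup := by
    rw [Multiset.nodup_iff_count_le_one]
    intro a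
    rw [count_roots]
    by_contra hcon
    push Not at hcon
    rw [one_lt_rootMultiplicity_iff_isRoot (hne 1)] at hcon
    obtain ⟨h1, h2⟩ := hcon
    have h3 := hc a (by simpa [IsRoot] using h2)
    have h4 : f.eval a = 1 := by simpa [IsRoot, sub_eq_zero] using h1
    rw [h4] at h3
    norm_num at h3
  set S := (f - C 1).roots.toFinset with hS
  have hScard : S.card = f.natDegree := by
    rw [hS, Multiset.toFinset_card_of_nodup hnodup, IsAlgClosed.card_roots_eq_natDegree, hnd]
  have hSm : ∀ i ∈ S, f.eval i = 1 := by
    intro i hi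
    have := (Multiset.mem_toFinset.mp hi)
    rw [mem_roots (hne 1)] at this
    simpa [IsRoot, sub_eq_zero] using this
  have hex : ∀ i, ∃ F : ℂ → ℂ, i ∈ S → ContinuousOn F {w | 0 ≤ w.re} ∧
      (∀ w : ℂ, 0 ≤ w.re → f.eval (F w) = w) ∧ F 1 = i := by
    intro i
    by_cases hi : i ∈ S
    · obtain ⟨F, hF⟩ := lift_extend f hdeg hc i (hSm i hi)
      exact ⟨F, fun _ => hF⟩
    · exact ⟨0, fun h => absurd h hi⟩
  choose g hg using hex
  have hsub : {w : ℂ | 0 < w.re} ⊆ {w : ℂ | 0 ≤ w.re} := fun w (hw : 0 < w.re) => hw.le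
  have hdist : ∀ i ∈ S, ∀ j ∈ S, i ≠ j → ∀ w : ℂ, 0 < w.re → g i w ≠ g j w := by
    intro i hi j hj hij w hw h
    have := lift_unique f hc (g i) (g j) ((hg i hi).1.mono hsub) ((hg j hj).1.mono hsub)
      (fun w hw => (hg i hi).2.1 w hw.le) (fun w hw => (hg j hj).2.1 w hw.le) w hw h 1 (by simp)
    rw [(hg i hi).2.2, (hg j hj).2.2] at this
    exact hij this
  have hfac : ∀ w : ℂ, 0 < w.re → f - C w = C f.leadingCoeff * ∏ i ∈ S, (X - C (g i w)) := by
    intro w hw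
    have hinj : Set.InjOn (fun i => g i w) S := by
      intro i hi j hj h
      by_contra hij
      exact hdist i hi j hj hij w hw h
    have hle : (S.image fun i => g i w).val ≤ (f - C w).roots := by
      rw [Multiset.le_iff_subset (Finset.nodup _)]
      intro z hz
      obtain ⟨i, hi, rfl⟩ := Finset.mem_image.mp hz
      rw [mem_roots (hne w)]
      simp [IsRoot, (hg i hi).2.1 w hw.le]
    have heq : (S.image fun i => g i w).val = (f - C w).roots := by
      refine Multiset.eq_of_le_of_card_le hle ?_
      rw [IsAlgClosed.card_roots_eq_natDegree, hnd, Finset.card_val,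
        Finset.card_image_of_injOn hinj, hScard]
    have h1 := C_leadingCoeff_mul_prod_multiset_X_sub_C (p := f - C w)
      IsAlgClosed.card_roots_eq_natDegree
    rw [← heq, hlc] at h1
    rw [← h1]
    congr 1
    exact (Finset.prod_image (f := fun z => X - C z) hinj)
  refine ⟨S, g, fun i hi => (hg i hi).1, fun i hi => (hg i hi).2.1, hdist, ?_⟩
  intro w hw
  apply Polynomial.funext
  intro z
  have : EqOn (fun w => (f - C w).eval z)
      (fun w => (C f.leadingCoeff * ∏ i ∈ S, (X - C (g i w))).eval z) {w : ℂ | 0 ≤ w.re} := by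
    refine EqOn.of_subset_closure (s := {w : ℂ | 0 < w.re}) ?_ ?_ ?_ hsub
      (by rw [Complex.closure_setOfPred_lt_re])
    · intro w hw
      simp only [hfac w hw]
    · simp only [eval_sub, eval_C]; fun_prop
    · simp only [eval_mul, eval_C, eval_prod, eval_sub, eval_X]
      refine continuousOn_const.mul (continuousOn_finsetProd _ fun i hi => ?_)
      exact continuousOn_const.sub (hg i hi).1
  exact this hw

/-- The retraction of `{Re f ≥ 0}` to `{Re f = 0}`. -/
lemma retraction (f : ℂ[X]) (hdeg : 0 < f.degree)
    (hc : ∀ ω, f.derivative.eval ω = 0 → (f.eval ω).re ≤ 0) :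
    ∃ r : ℂ → ℂ, ContinuousOn r {z | 0 ≤ (f.eval z).re} ∧
      (∀ z, 0 ≤ (f.eval z).re → (f.eval (r z)).re = 0) ∧
      (∀ z, (f.eval z).re = 0 → r z = z) := by
  classical
  obtain ⟨S, g, hg, hfg, hdist, hfac⟩ := core f hdeg hc
  have hlc : f.leadingCoeff ≠ 0 := by
    rw [Ne, leadingCoeff_eq_zero]; rintro rfl; simp at hdeg
  have hex : ∀ z, ∃ i, 0 ≤ (f.eval z).re → i ∈ S ∧ g i (f.eval z) = z := by
    intro z
    by_cases hz : 0 ≤ (f.eval z).re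
    · have h1 := congrArg (eval z) (hfac (f.eval z) hz)
      simp only [eval_sub, eval_C, sub_self, eval_mul, eval_prod, eval_X] at h1
      have h2 := (mul_eq_zero.mp h1.symm).resolve_left hlc
      obtain ⟨i, hi, h3⟩ := Finset.prod_eq_zero_iff.mp h2
      exact ⟨i, fun _ => ⟨hi, (sub_eq_zero.mp h3).symm⟩⟩
    · exact ⟨0, fun h => absurd h hz⟩
  choose ι hι using hex
  let q : ℂ → ℂ := fun w => ((w.im : ℝ) : ℂ) * Complex.I
  have hqre : ∀ w, (q w).re = 0 := fun w => by simp [q]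
  have hq0 : ∀ w : ℂ, w.re = 0 → q w = w := fun w hw => by
    apply Complex.ext <;> simp [q, hw]
  have hqc : Continuous q := by fun_prop
  have hfc : Continuous fun z => f.eval z := f.continuous
  have key : ∀ i ∈ S, ∀ z, 0 ≤ (f.eval z).re → g i (f.eval z) = z →
      g (ι z) (q (f.eval z)) = g i (q (f.eval z)) := by
    intro i hi z hz hgi
    obtain ⟨h1, h2⟩ := hι z hz
    rcases hz.eq_or_lt with h0 | h0
    · rw [hq0 _ h0.symm, h2, hgi]
    · have : ι z = i := by
        by_contra hne
        exact hdist _ h1 _ hi hne _ h0 (h2.trans hgi.symm)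
      rw [this]
  have hclosed : IsClosed {z : ℂ | 0 ≤ (f.eval z).re} :=
    isClosed_le continuous_const (Complex.continuous_re.comp hfc)
  let P : S → Set ℂ := fun i => {z | 0 ≤ (f.eval z).re} ∩ {z | g i (f.eval z) - z = 0}
  have hPc : ∀ i, IsClosed (P i) := by
    intro i
    have h1 : ContinuousOn (fun z => g i (f.eval z) - z) {z : ℂ | 0 ≤ (f.eval z).re} :=
      ((hg i i.2).comp hfc.continuousOn (fun z hz => hz)).sub continuousOn_id
    exact h1.preimage_isClosed_of_isClosed hclosed isClosed_singleton
  have hcov : {z : ℂ | 0 ≤ (f.eval z).re} = ⋃ i, P i := by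
    ext z
    rw [mem_iUnion]
    constructor
    · intro hz
      exact ⟨⟨ι z, (hι z hz).1⟩, hz, sub_eq_zero.mpr (hι z hz).2⟩
    · rintro ⟨i, hi⟩
      exact hi.1
  refine ⟨fun z => g (ι z) (q (f.eval z)), ?_, ?_, ?_⟩
  · rw [hcov]
    refine (locallyFinite_of_finite P).continuousOn_iUnion hPc ?_
    intro i
    refine ContinuousOn.congr (f := fun z => g i (q (f.eval z))) ?_ ?_
    · exact (hg i i.2).comp (hqc.comp hfc).continuousOn (fun z _ => (hqre _).ge)
    · intro z hz
      exact key i i.2 z hz.1 (sub_eq_zero.mp hz.2)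
  · intro z hz
    simp only
    rw [hfg _ (hι z hz).1 _ (hqre _).ge, hqre]
  · intro z hz
    simp only
    rw [hq0 _ hz, (hι z hz.ge).2]

lemma connected_of_crit (f : ℂ[X]) (hdeg : 0 < f.degree)
    (hc : ∀ ω, f.derivative.eval ω = 0 → (f.eval ω).re = 0) :
    IsConnected {z : ℂ | (f.eval z).re = 0} := by
  classical
  obtain ⟨r, hr1, hr2, hr3⟩ := retraction f hdeg (fun ω h => (hc ω h).le)
  obtain ⟨s, hs1, hs2, hs3⟩ := retraction (-f) (by simpa using hdeg) (fun ω h => by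
    have := hc ω (by simpa using h)
    simp [this])
  simp only [eval_neg, Complex.neg_re, neg_eq_zero, Left.nonneg_neg_iff] at hs1 hs2 hs3
  have hfc : Continuous fun z => (f.eval z).re := Complex.continuous_re.comp f.continuous
  let R : ℂ → ℂ := fun z => if 0 ≤ (f.eval z).re then r z else s z
  have h1 : ContinuousOn R {z | 0 ≤ (f.eval z).re} :=
    hr1.congr fun z hz => if_pos hz
  have h2 : ContinuousOn R {z | (f.eval z).re ≤ 0} := by
    refine hs1.congr fun z hz => ?_
    by_cases h : 0 ≤ (f.eval z).re
    · have h0 : (f.eval z).re = 0 := le_antisymm hz h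
      simp only [R, if_pos h, hr3 z h0, hs3 z h0]
    · exact if_neg h
  have hR : Continuous R := by
    rw [← continuousOn_univ]
    have := h1.union_of_isClosed h2 (isClosed_le continuous_const hfc)
      (isClosed_le hfc continuous_const)
    refine this.mono fun z _ => ?_
    exact le_total 0 (f.eval z).re
  have hrange : {z : ℂ | (f.eval z).re = 0} = range R := by
    ext z
    constructor
    · intro hz
      refine ⟨z, ?_⟩
      have hz' : (f.eval z).re = 0 := hz
      simp only [R, if_pos hz'.ge, hr3 z hz']
    · rintro ⟨y, rfl⟩
      change (f.eval (R y)).re = 0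
      by_cases h : 0 ≤ (f.eval y).re
      · simp only [R, if_pos h, hr2 y h]
      · simp only [R, if_neg h, hs2 y (le_of_not_ge h)]
  rw [hrange]
  exact isConnected_range hR

/-- exponential uniqueness -/
lemma exp_const {A : Type*} [TopologicalSpace A] {s : Set A} (hs : IsPreconnected s) (g : A → ℂ)
    (hg : ContinuousOn g s) (k : ℂ) (h : ∀ a ∈ s, Complex.exp (g a) = k) {a b : A}
    (ha : a ∈ s) (hb : b ∈ s) : g a = g b :=
  Complex.isCoveringMap_exp.constOn_of_comp hs hg
    (fun a ha b hb => Subtype.ext ((h a ha).trans (h b hb).symm)) ha hb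

lemma no_log (ω k : ℂ) (L : ℂ → ℂ) (hL : ContinuousOn L {ω}ᶜ)
    (h : ∀ z, z ≠ ω → Complex.exp (L z) = k * (z - ω)) : False := by
  have hne : ∀ θ : ℝ, ω + Complex.exp (θ * Complex.I) ≠ ω := fun θ => by
    simp [Complex.exp_ne_zero]
  have hcont : Continuous fun θ : ℝ => L (ω + Complex.exp (θ * Complex.I)) - θ * Complex.I := by
    refine Continuous.sub (hL.comp_continuous (by fun_prop) fun θ => hne θ) (by fun_prop)
  have := exp_const isPreconnected_univ _ hcont.continuousOn k (fun θ _ => by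
    rw [Complex.exp_sub, h _ (hne θ)]
    have := Complex.exp_ne_zero (θ * Complex.I)
    field_simp
    ring) (mem_univ (0 : ℝ)) (mem_univ (2 * Real.pi))
  simp only [Complex.ofReal_zero, zero_mul, Complex.exp_zero, sub_zero, Complex.ofReal_mul,
    Complex.ofReal_ofNat, Complex.exp_two_pi_mul_I] at this
  exact Complex.two_pi_I_ne_zero (by linear_combination this)

/-- a branch of the logarithm off a path to infinity -/
lemma exists_log (γ : ℝ → ℂ) (hγ : ContinuousOn γ (Ici 0)) (hinf : Tendsto γ atTop (cocompact ℂ))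
    (a : ℂ) (ha : ∀ t, 0 ≤ t → γ t ≠ a) :
    ∃ L : ℂ → ℂ, ContinuousOn L (γ '' Ici 0)ᶜ ∧
      ∀ z, z ∉ γ '' Ici 0 → Complex.exp (L z) = (a - γ 0)⁻¹ * (z - γ 0) := by
  classical
  let q : ℝ → ℂ := fun s => if s ≤ 0 then 0 else (a - γ ((1 - s) / s))⁻¹
  have hq : ContinuousOn q (Icc 0 1) := by
    intro s hs
    rcases hs.1.eq_or_lt with h0 | h0
    · subst h0
      have hq0 : q 0 = 0 := if_pos le_rfl
      have ht : Tendsto (fun s : ℝ => (1 - s) / s) (𝓝[>] 0) atTop := by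
        have h1 : Tendsto (fun s : ℝ => s⁻¹ - 1) (𝓝[>] 0) atTop :=
          tendsto_atTop_add_const_right _ _ tendsto_inv_nhdsGT_zero
        refine h1.congr' ?_
        filter_upwards [self_mem_nhdsWithin] with s hs
        have : s ≠ 0 := ne_of_gt hs
        field_simp
      have h2 : Tendsto (fun s : ℝ => (a - γ ((1 - s) / s))⁻¹) (𝓝[>] 0) (𝓝 0) := by
        refine tendsto_inv₀_cobounded.comp ?_
        rw [Metric.cobounded_eq_cocompact]
        exact ((Homeomorph.subLeft a).isClosedEmbedding.tendsto_cocompact).comp (hinf.comp ht)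
      have h3 : Tendsto q (𝓝[>] 0) (𝓝 0) := by
        refine h2.congr' ?_
        filter_upwards [self_mem_nhdsWithin] with s hs
        exact (if_neg (not_le.mpr hs)).symm
      have h4 : ContinuousWithinAt q (Ioi 0) 0 := by
        rw [ContinuousWithinAt, hq0]; exact h3
      have h5 : ContinuousWithinAt q (insert 0 (Ioi 0)) 0 := h4.insert
      exact h5.mono fun x hx => by
        rcases hx.1.eq_or_lt with h | h
        · exact Or.inl h.symm
        · exact Or.inr h
    · have h1 : ContinuousOn (fun s : ℝ => (a - γ ((1 - s) / s))⁻¹) (Ioc 0 1) := by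
        refine ContinuousOn.inv₀ (continuousOn_const.sub (hγ.comp ?_ ?_)) ?_
        · exact ContinuousOn.div (by fun_prop) (by fun_prop) fun x hx => hx.1.ne'
        · intro x hx
          exact div_nonneg (by linarith [hx.2]) hx.1.le
        · intro x hx h
          exact ha _ (div_nonneg (by linarith [hx.2]) hx.1.le) (sub_eq_zero.mp h).symm
      have h2 : ContinuousOn q (Ioc 0 1) := h1.congr fun x hx => if_neg (not_le.mpr hx.1)
      refine (h2 s ⟨h0, hs.2⟩).mono_of_mem_nhdsWithin ?_
      have : Icc 0 1 ∩ Ioi 0 ∈ 𝓝[Icc 0 1] s :=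
        inter_mem self_mem_nhdsWithin (nhdsWithin_le_nhds (Ioi_mem_nhds h0))
      exact mem_of_superset this fun x hx => ⟨hx.2, hx.1.2⟩
  have hqI : Continuous fun s : unitInterval => q s := hq.domRestrict
  have hne : ∀ (s : unitInterval) (z : ((γ '' Ici 0)ᶜ : Set ℂ)), 1 + ((z : ℂ) - a) * q s ≠ 0 := by
    intro s z
    by_cases hs : (s : ℝ) ≤ 0
    · simp [q, hs]
    · have hs' : 0 < (s : ℝ) := not_le.mp hs
      have ht : 0 ≤ (1 - (s : ℝ)) / s := div_nonneg (by linarith [s.2.2]) hs'.le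
      have h1 : a - γ ((1 - s) / s) ≠ 0 := fun h => ha _ ht (sub_eq_zero.mp h).symm
      simp only [q, if_neg hs]
      intro h
      apply z.2
      refine ⟨(1 - s) / s, ht, ?_⟩
      field_simp at h
      linear_combination -h
  let H : C(unitInterval × ((γ '' Ici 0)ᶜ : Set ℂ), {z : ℂ // z ≠ 0}) :=
    ⟨fun x => ⟨1 + ((x.2 : ℂ) - a) * q x.1, hne x.1 x.2⟩, by
      refine Continuous.subtype_mk ?_ _
      have := hqI.comp (continuous_fst (X := unitInterval) (Y := ((γ '' Ici 0)ᶜ : Set ℂ)))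
      exact continuous_const.add (((continuous_subtype_val.comp continuous_snd).sub
        continuous_const).mul this)⟩
  have hH0 : ∀ z, H (0, z) = ⟨Complex.exp ((ContinuousMap.const _ (0 : ℂ) :
      C(((γ '' Ici 0)ᶜ : Set ℂ), ℂ)) z), Complex.exp_ne_zero _⟩ := by
    intro z
    apply Subtype.ext
    simp [H, q]
  let Λ := Complex.isCoveringMap_exp.liftHomotopy H (ContinuousMap.const _ 0) hH0
  have hΛ : ∀ z, Complex.exp (Λ (1, z)) = 1 + ((z : ℂ) - a) * (a - γ 0)⁻¹ := by
    intro z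
    have := congrArg Subtype.val (congrFun
      (Complex.isCoveringMap_exp.liftHomotopy_lifts H (ContinuousMap.const _ 0) hH0) (1, z))
    refine this.trans ?_
    simp [H, q]
  let L : ℂ → ℂ := fun z => if h : z ∈ (γ '' Ici 0)ᶜ then Λ (1, ⟨z, h⟩) else 0
  have hLv : ∀ z (h : z ∈ (γ '' Ici 0)ᶜ), L z = Λ (1, ⟨z, h⟩) := fun z h => dif_pos h
  refine ⟨L, ?_, ?_⟩
  · rw [continuousOn_iff_continuous_domRestrict]
    have : Continuous fun z : ((γ '' Ici 0)ᶜ : Set ℂ) => Λ (1, z) :=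
      Λ.continuous.comp (by fun_prop)
    exact this.congr fun z => (hLv z z.2).symm
  · intro z hz
    rw [hLv z hz, hΛ]
    have : a - γ 0 ≠ 0 := fun h => ha 0 le_rfl (sub_eq_zero.mp h).symm
    field_simp
    ring

lemma poly_isOpenMap (f : ℂ[X]) (hdeg : 0 < f.degree) : IsOpenMap fun z => f.eval z := by
  have han : AnalyticOnNhd ℂ (fun z => f.eval z) univ :=
    fun z _ => f.differentiable.analyticAt z
  rcases han.is_constant_or_isOpen isPreconnected_univ with ⟨w, hw⟩ | h
  · exfalso
    have : f = C w := Polynomial.funext fun z => by simpa using hw z (mem_univ z)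
    rw [this] at hdeg
    exact absurd hdeg (not_lt.mpr degree_C_le)
  · exact fun s hs => h s (subset_univ _) hs

lemma ray_compl_preconnected : IsPreconnected {w : ℂ | 0 ≤ w.re ∧ w.im = 0}ᶜ := by
  have h1 : IsPreconnected Complex.slitPlane :=
    (Complex.starConvex_one_slitPlane.isPathConnected
      Complex.one_mem_slitPlane).isConnected.isPreconnected
  have h2 := h1.image (fun w => -w) continuous_neg.continuousOn
  convert h2 using 1
  ext w
  constructor
  · intro hw
    refine ⟨-w, ?_, neg_neg w⟩
    rw [Complex.mem_slitPlane_iff]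
    by_contra hcon
    push Not at hcon
    apply hw
    simpa using hcon
  · rintro ⟨v, hv, rfl⟩ ⟨h3, h4⟩
    rw [Complex.mem_slitPlane_iff] at hv
    simp at h3 h4
    rcases hv with h | h
    · linarith
    · exact h h4

lemma two_branches (f : ℂ[X]) (ω a : ℂ) (ha : a ≠ 0) (h1 : f.derivative.eval ω = 0)
    (h0 : f.eval ω = 0) (S : Finset ℂ) (p : ℂ → ℂ)
    (hfac : f = C a * ∏ i ∈ S, (X - C (p i))) :
    ∃ i ∈ S, ∃ j ∈ S, i ≠ j ∧ p i = ω ∧ p j = ω := by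
  classical
  obtain ⟨i, hi, hpi⟩ : ∃ i ∈ S, p i = ω := by
    rw [hfac] at h0
    simp only [eval_mul, eval_C, eval_prod, eval_sub, eval_X] at h0
    obtain ⟨i, hi, h⟩ := Finset.prod_eq_zero_iff.mp ((mul_eq_zero.mp h0).resolve_left ha)
    exact ⟨i, hi, (sub_eq_zero.mp h).symm⟩
  rw [← Finset.mul_prod_erase S _ hi, hpi] at hfac
  rw [hfac] at h1
  simp only [derivative_mul, derivative_C, zero_mul, zero_add, derivative_sub, derivative_X,
    sub_zero, one_mul, eval_mul, eval_C, eval_add, eval_sub, eval_X, sub_self, add_zero,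
    eval_prod] at h1
  obtain ⟨j, hj, h⟩ := Finset.prod_eq_zero_iff.mp ((mul_eq_zero.mp h1).resolve_left ha)
  exact ⟨i, hi, j, Finset.mem_of_mem_erase hj, (Finset.ne_of_mem_erase hj).symm, hpi,
    (sub_eq_zero.mp h).symm⟩

lemma not_preconnected (f : ℂ[X]) (hdeg : 0 < f.degree) (ω : ℂ) (hω : f.eval ω = 0)
    (hω' : f.derivative.eval ω = 0)
    (hc : ∀ ω, f.derivative.eval ω = 0 → (f.eval ω).re ≤ 0) (c : ℝ) (hcpos : 0 < c)
    (hR : IsPreconnected {z : ℂ | (f.eval z).re = -c}) : False := by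
  classical
  obtain ⟨S, g, hg, hfg, hdist, hfac⟩ := core f hdeg hc
  have hlc : f.leadingCoeff ≠ 0 := by
    rw [Ne, leadingCoeff_eq_zero]; rintro rfl; simp at hdeg
  have hfc : Continuous fun z => f.eval z := f.continuous
  have hfac0 := hfac 0 (by simp)
  rw [C_0, sub_zero] at hfac0
  obtain ⟨i, hi, j, hj, hij, hgi, hgj⟩ :=
    two_branches f ω _ hlc hω' hω S (fun i => g i 0) hfac0
  -- base point
  obtain ⟨a, hfa⟩ : ∃ a, f.eval a = -c := by
    obtain ⟨a, ha⟩ := IsAlgClosed.exists_root (f - C (-c : ℂ))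
      (by rw [degree_sub_C hdeg]; exact hdeg.ne')
    refine ⟨a, ?_⟩
    simpa [IsRoot, add_eq_zero_iff_eq_neg] using ha
  set ρ : Set ℂ := {w : ℂ | 0 ≤ w.re ∧ w.im = 0} with hρ
  have hρc : IsClosed ρ :=
    (isClosed_le continuous_const Complex.continuous_re).inter
      (isClosed_eq Complex.continuous_im continuous_const)
  let K : ℂ → Set ℂ := fun k => (fun t : ℝ => g k t) '' Ici 0
  have hKf : ∀ k ∈ S, ∀ z ∈ K k, f.eval z ∈ ρ := by
    rintro k hk _ ⟨t, ht, rfl⟩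
    have ht : 0 ≤ t := ht
    simp only [hfg k hk t (by simpa using ht)]
    exact ⟨by simpa using ht, by simp⟩
  have hKc : ∀ k ∈ S, IsClosed (K k) := by
    intro k hk
    have h1 : ContinuousOn (fun z => g k (f.eval z) - z) (f.eval ⁻¹' ρ) :=
      ((hg k hk).comp hfc.continuousOn (fun z hz => hz.1)).sub continuousOn_id
    have h2 := h1.preimage_isClosed_of_isClosed (hρc.preimage hfc) (isClosed_singleton (x := 0))
    convert h2 using 1
    ext z
    constructor
    · intro hz
      refine ⟨hKf k hk z hz, ?_⟩
      obtain ⟨t, ht, rfl⟩ := hz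
      have ht : 0 ≤ t := ht
      simp only [mem_preimage, mem_singleton_iff, hfg k hk t (by simpa using ht), sub_self]
    · rintro ⟨h3, h4⟩
      refine ⟨(f.eval z).re, h3.1, ?_⟩
      have : (((f.eval z).re : ℝ) : ℂ) = f.eval z := Complex.ext (by simp) (by simpa using h3.2.symm)
      simp only [this]
      exact sub_eq_zero.mp h4
  have hlog : ∀ k ∈ S, g k 0 = ω → ∃ L : ℂ → ℂ, ContinuousOn L (K k)ᶜ ∧
      ∀ z, z ∉ K k → Complex.exp (L z) = (a - ω)⁻¹ * (z - ω) := by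
    intro k hk hk0
    have hcont : ContinuousOn (fun t : ℝ => g k t) (Ici 0) :=
      (hg k hk).comp Complex.continuous_ofReal.continuousOn (fun t ht => by simpa using ht)
    have := exists_log (fun t : ℝ => g k t) hcont ?_ a ?_
    · simpa only [Complex.ofReal_zero, hk0] using this
    · refine Tendsto.mono_right ?_ (Filter.comap_cocompact_le hfc)
      rw [tendsto_comap_iff]
      have h1 : Tendsto (fun t : ℝ => (t : ℂ)) atTop (cocompact ℂ) := by
        rw [← Metric.cobounded_eq_cocompact, ← tendsto_norm_atTop_iff_cobounded]
        simpa using tendsto_abs_atTop_atTop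
      refine h1.congr' ?_
      filter_upwards [eventually_ge_atTop 0] with t ht
      exact (hfg k hk t (by simpa using ht)).symm
    · intro t ht h
      have h2 := hfg k hk t (by simpa using ht)
      rw [h, hfa] at h2
      have := congrArg Complex.re h2
      simp at this
      linarith
  obtain ⟨L1, hL1, hE1⟩ := hlog i hi hgi
  obtain ⟨L2, hL2, hE2⟩ := hlog j hj hgj
  have haω : a ≠ ω := by
    rintro rfl
    rw [hω] at hfa
    have := congrArg Complex.re hfa
    simp at this
    linarith
  have hωi : ω ∈ K i := ⟨0, self_mem_Ici, by simpa using hgi⟩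
  have hωj : ω ∈ K j := ⟨0, self_mem_Ici, by simpa using hgj⟩
  have hinter : ∀ z, z ∈ K i → z ∈ K j → z = ω := by
    rintro z ⟨s, hs, rfl⟩ ⟨t, ht, h⟩
    have hs : 0 ≤ s := hs
    have ht : 0 ≤ t := ht
    have h1 := hfg j hj t (by simpa using ht)
    simp only at h
    rw [h, hfg i hi s (by simpa using hs)] at h1
    have hst : s = t := by exact_mod_cast h1
    subst hst
    rcases hs.eq_or_lt with h0 | h0
    · subst h0; simpa using hgi
    · exact absurd h.symm (hdist i hi j hj hij s (by simpa using h0))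
  set Γ : Set ℂ := K i ∪ K j with hΓ
  have hΓc : IsClosed Γ := (hKc i hi).union (hKc j hj)
  have hΓf : ∀ z ∈ Γ, f.eval z ∈ ρ := by
    rintro z (hz | hz)
    · exact hKf i hi z hz
    · exact hKf j hj z hz
  let h : ℂ → ℂ := fun z => L1 z - L2 z
  have hhc : ContinuousOn h Γᶜ :=
    (hL1.mono (compl_subset_compl.mpr subset_union_left)).sub
      (hL2.mono (compl_subset_compl.mpr subset_union_right))
  have hhe : ∀ z ∈ Γᶜ, Complex.exp (h z) = 1 := by
    intro z hz
    have hz1 : z ∉ K i := fun h => hz (Or.inl h)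
    have hz2 : z ∉ K j := fun h => hz (Or.inr h)
    have hzω : z - ω ≠ 0 := sub_ne_zero.mpr (by rintro rfl; exact hz1 hωi)
    rw [Complex.exp_sub, hE1 z hz1, hE2 z hz2, div_self]
    exact mul_ne_zero (inv_ne_zero (sub_ne_zero.mpr haω)) hzω
  have hRΓ : {z : ℂ | (f.eval z).re = -c} ⊆ Γᶜ := by
    intro z hz hzΓ
    have h1 := (hΓf z hzΓ).1
    have hz : (f.eval z).re = -c := hz
    linarith
  have haR : a ∈ {z : ℂ | (f.eval z).re = -c} := by simp [hfa]
  set d := h a with hd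
  have hRd : ∀ z, (f.eval z).re = -c → h z = d := fun z hz =>
    exp_const hR h (hhc.mono hRΓ) 1 (fun z hz => hhe z (hRΓ hz)) hz haR
  have hdexp : Complex.exp d = 1 := hhe a (hRΓ haR)
  -- the bad set is empty
  have hV : ∀ z ∈ Γᶜ, h z = d := by
    by_contra hcon
    push Not at hcon
    obtain ⟨z0, hz0, hz0d⟩ := hcon
    set V : Set ℂ := Γᶜ ∩ h ⁻¹' {d}ᶜ with hVdef
    have hVo : IsOpen V := hhc.isOpen_inter_preimage hΓc.isOpen_compl isOpen_compl_singleton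
    have hWo : IsOpen (Γᶜ ∩ h ⁻¹' Metric.ball d 1) :=
      hhc.isOpen_inter_preimage hΓc.isOpen_compl Metric.isOpen_ball
    have hball : ∀ z ∈ Γᶜ, h z ∈ Metric.ball d 1 → h z = d := by
      intro z hz hzb
      have h1 : Complex.exp (h z) = Complex.exp d := by rw [hhe z hz, hdexp]
      obtain ⟨n, hn⟩ := Complex.exp_eq_exp_iff_exists_int.mp h1
      rw [hn, Metric.mem_ball, dist_eq_norm, add_sub_cancel_left, norm_mul,
        Complex.norm_intCast] at hzb
      have h2 : ‖(2 * Real.pi * Complex.I : ℂ)‖ = 2 * Real.pi := by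
        simp [abs_of_pos Real.pi_pos]
      rw [h2] at hzb
      have h3 : n = 0 := by
        by_contra hn0
        have h4 : (1 : ℝ) ≤ |(n : ℝ)| := by exact_mod_cast Int.one_le_abs hn0
        nlinarith [Real.pi_gt_three]
      rw [hn, h3]; simp
    have hVΓ : IsClosed (V ∪ Γ) := by
      rw [← isOpen_compl_iff]
      convert hWo using 1
      ext z
      constructor
      · intro hz
        have hzΓ : z ∈ Γᶜ := fun h => hz (Or.inr h)
        have hzd : h z = d := by
          by_contra hne
          exact hz (Or.inl ⟨hzΓ, hne⟩)
        exact ⟨hzΓ, by simp [hzd]⟩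
      · rintro ⟨hz1, hz2⟩ (hz3 | hz3)
        · exact hz3.2 (hball z hz1 hz2)
        · exact hz1 hz3
    have hu : IsOpen (f.eval '' V) := poly_isOpenMap f hdeg V hVo
    have hv : IsClosed (f.eval '' (V ∪ Γ)) := f.isClosedMap_eval _ hVΓ
    have hsub : ρᶜ ⊆ f.eval '' V ∪ (f.eval '' (V ∪ Γ))ᶜ := by
      intro w hw
      by_cases hwV : w ∈ f.eval '' (V ∪ Γ)
      · obtain ⟨z, hz | hz, rfl⟩ := hwV
        · exact Or.inl ⟨z, hz, rfl⟩
        · exact absurd (hΓf z hz) hw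
      · exact Or.inr hwV
    have hdisj : Disjoint (f.eval '' V) (f.eval '' (V ∪ Γ))ᶜ :=
      disjoint_compl_right.mono_left (image_mono subset_union_left)
    have hnon : (ρᶜ ∩ f.eval '' V).Nonempty := by
      by_contra hemp
      have hsubρ : f.eval '' V ⊆ ρ := by
        intro w hw
        by_contra hwρ
        exact hemp ⟨w, hwρ, hw⟩
      have hw0 : f.eval z0 ∈ f.eval '' V := ⟨z0, ⟨hz0, hz0d⟩, rfl⟩
      obtain ⟨ε, hε, hεb⟩ := Metric.isOpen_iff.mp hu _ hw0
      have h1 := hsubρ (hεb (Metric.mem_ball_self hε))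
      have h2 := hsubρ (hεb (show f.eval z0 + (ε / 2 : ℝ) * Complex.I ∈ _ by
        rw [Metric.mem_ball, dist_eq_norm, add_sub_cancel_left, norm_mul, Complex.norm_I,
          Complex.norm_real, Real.norm_of_nonneg (by positivity)]
        linarith))
      have h3 := h2.2
      rw [Complex.add_im, h1.2] at h3
      simp at h3
      exact hε.ne' h3
    have hall := ray_compl_preconnected.subset_left_of_subset_union hu hv.isOpen_compl hdisj hsub
      hnon
    obtain ⟨z, hzV, hz⟩ := hall (show (-c : ℂ) ∈ ρᶜ from fun h => by
      have := h.1
      simp at this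
      linarith)
    exact hzV.2 (hRd z (by simp [hz]))
  -- glue
  let L : ℂ → ℂ := fun z => if z ∈ K i then L2 z + d else L1 z
  have hLi : ContinuousOn L (K i)ᶜ := hL1.congr fun z hz => if_neg hz
  have hLj' : ∀ z ∈ (K j)ᶜ, L z = L2 z + d := by
    intro z hz
    by_cases hzi : z ∈ K i
    · exact if_pos hzi
    · have := hV z (fun h => h.elim hzi hz)
      simp only [L, if_neg hzi, ← this, h]
      ring
  have hLj : ContinuousOn L (K j)ᶜ := (hL2.add continuousOn_const).congr hLj'
  have hLc := hLi.union_of_isOpen hLj (hKc i hi).isOpen_compl (hKc j hj).isOpen_compl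
  refine no_log ω (a - ω)⁻¹ L (hLc.mono ?_) ?_
  · intro z hz
    by_cases hzi : z ∈ K i
    · exact Or.inr fun hzj => hz (hinter z hzi hzj)
    · exact Or.inl hzi
  · intro z hz
    by_cases hzi : z ∈ K i
    · have hzj : z ∉ K j := fun hzj => hz (hinter z hzi hzj)
      rw [hLj' z hzj, Complex.exp_add, hdexp, mul_one, hE2 z hzj]
    · simp only [L, if_neg hzi]
      exact hE1 z hzi

lemma crit_le (f : ℂ[X]) (hdeg : 0 < f.degree) (hR : IsPreconnected {z : ℂ | (f.eval z).re = 0}) :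
    ∀ ω, f.derivative.eval ω = 0 → (f.eval ω).re ≤ 0 := by
  classical
  by_contra hcon
  push Not at hcon
  obtain ⟨ω0, h0, h0'⟩ := hcon
  have hd0 : f.derivative ≠ 0 := by
    intro h
    have := derivative_eq_zero.mp h
    have h2 := natDegree_pos_iff_degree_pos.mpr hdeg
    omega
  have hmem : ∀ ω, ω ∈ f.derivative.roots.toFinset ↔ f.derivative.eval ω = 0 := by
    intro ω
    rw [Multiset.mem_toFinset, mem_roots hd0, IsRoot]
  obtain ⟨ω, hω, hmax⟩ := Finset.exists_max_image f.derivative.roots.toFinset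
    (fun ω => (f.eval ω).re) ⟨ω0, (hmem ω0).mpr h0⟩
  have hωd := (hmem ω).mp hω
  have hpos : 0 < (f.eval ω).re := h0'.trans_le (hmax ω0 ((hmem ω0).mpr h0))
  refine not_preconnected (f - C (f.eval ω)) (by rwa [degree_sub_C hdeg]) ω (by simp)
    (by simpa using hωd) ?_ (f.eval ω).re hpos ?_
  · intro z hz
    have := hmax z ((hmem z).mpr (by simpa using hz))
    simpa using this
  · convert hR using 3
    simp [sub_eq_neg_self]

lemma main_re (f : ℂ[X]) (hdeg : 0 < f.degree) : IsConnected {z : ℂ | (f.eval z).re = 0} ↔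
      ∀ ω : ℂ, f.derivative.eval ω = 0 → (f.eval ω).re = 0 := by
  refine ⟨fun h ω hω => le_antisymm (crit_le f hdeg h.isPreconnected ω hω) ?_,
    connected_of_crit f hdeg⟩
  have := crit_le (-f) (by simpa using hdeg) (by simpa using h.isPreconnected) ω (by simpa using hω)
  simpa using this

/-- For a complex polynomial `f` of degree `n ≥ 1`: `R(f)` is connected (a single tree)
iff every critical value of `f` has real part `0`, and `I(f)` is connected iff every
critical value of `f` has imaginary part `0`. -/
theorem stmt6 (n : ℕ) (hn : 1 ≤ n) (f : Polynomial ℂ) (hd : f.natDegree = n) :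
    (IsConnected {z : ℂ | (f.eval z).re = 0} ↔
      ∀ ω : ℂ, (Polynomial.derivative f).eval ω = 0 → (f.eval ω).re = 0) ∧
    (IsConnected {z : ℂ | (f.eval z).im = 0} ↔
      ∀ ω : ℂ, (Polynomial.derivative f).eval ω = 0 → (f.eval ω).im = 0) := by
  have hdeg : 0 < f.degree := natDegree_pos_iff_degree_pos.mp (by omega)
  refine ⟨main_re f hdeg, ?_⟩
  have h := main_re (C Complex.I * f) (by rwa [degree_C_mul Complex.I_ne_zero])
  simpa using h
end

section
/- For every n ≥ 1, the number of non-singular combinatorial n-basketballs equals C(4n, n)/(3n+1). Here a non-singular combinatorial n-basketball is a pair (R, I) where R is a non-crossing perfect matching of the odd numbers {1, 3, ..., 4n−1} and I is a non-crossing perfect matching of the even numbers {0, 2, ..., 4n−2} (all 4n points placed in cyclic order on a circle), such that each pair of R crosses exactly one pair of I and each pair of I crosses exactly one pair of R; two pairs {a, b} and {c, d} cross when exactly one of c, d lies strictly between a and b in the cyclic order. -/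
/-- Two chords `p` and `q` of a circle with `4n` labelled points (each chord recorded as
an ordered pair with smaller endpoint first) cross when exactly one endpoint of `q`
lies strictly between the endpoints of `p`. -/
def ChordCrosses {m : ℕ} (p q : Fin m × Fin m) : Prop :=
  Xor' (p.1 < q.1 ∧ q.1 < p.2) (p.1 < q.2 ∧ q.2 < p.2)

inductive QTree : Type
  | leaf : QTree
  | node : QTree → QTree → QTree → QTree → QTree

namespace QTree

def size : QTree → ℕ
  | leaf => 0
  | node a b c d => a.size + b.size + c.size + d.size + 1

/-- The chords of the basketball coded by a quaternary tree, starting at offset `o`. -/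
def chords : QTree → ℕ → Finset (ℕ × ℕ)
  | leaf, _ => ∅
  | node a b c d, o =>
    ((((({(o, o + 4 * a.size + 4 * b.size + 2),
      (o + 4 * a.size + 1, o + 4 * a.size + 4 * b.size + 4 * c.size + 3)} : Finset (ℕ × ℕ))
      ∪ a.chords (o + 1)) ∪ b.chords (o + 4 * a.size + 2))
      ∪ c.chords (o + 4 * a.size + 4 * b.size + 3))
      ∪ d.chords (o + 4 * a.size + 4 * b.size + 4 * c.size + 4))

/-- number of forests with `k` trees and `n` nodes -/
def g : ℕ → ℕ → ℕ
  | 0, _ => 1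
  | _ + 1, 0 => 0
  | n + 1, k + 1 => g (n + 1) k + g n (k + 4)

theorem g_closed (n k : ℕ) : g n k * (4 * n + k) = k * Nat.choose (4 * n + k) n := by
  induction n generalizing k with
  | zero => simp [g]
  | succ n ihn =>
    induction k with
    | zero => simp [g]
    | succ k ihk =>
      have h1 := ihn (k + 4)
      rw [g]
      obtain ⟨M, hM⟩ : ∃ M, M = 4 * (n + 1) + k := ⟨_, rfl⟩
      have e1 : 4 * n + (k + 4) = M := by omega
      have e2 : 4 * (n + 1) + (k + 1) = M + 1 := by omega
      rw [e1] at h1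
      rw [← hM] at ihk
      rw [e2, Nat.choose_succ_succ]
      have h3 := Nat.choose_succ_right_eq M n
      have hMn : n ≤ M := by omega
      apply Nat.eq_of_mul_eq_mul_left (show 0 < M by omega)
      have hk : (k : ℤ) = M - 4 * (n + 1) := by omega
      zify [hMn] at *
      rw [hk] at *
      linear_combination (M + 1 : ℤ) * ihk + (M + 1 : ℤ) * h1 - 4 * h3

theorem g_one (n : ℕ) : g n 1 = Nat.choose (4 * n) n / (3 * n + 1) := by
  have h := g_closed n 1
  have h3 := Nat.choose_mul_succ_eq (4 * n) n
  have e : 4 * n + 1 - n = 3 * n + 1 := by omega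
  rw [e] at h3
  symm
  apply Nat.div_eq_of_eq_mul_left (by omega)
  apply Nat.eq_of_mul_eq_mul_right (show 0 < 4 * n + 1 by omega)
  rw [one_mul] at h
  rw [h3, ← h]
  ring

theorem forests (n k : ℕ) : ∃ S : Finset (List QTree), S.card = g n k ∧
    ∀ l, l ∈ S ↔ l.length = k ∧ (l.map size).sum = n := by
  classical
  induction n generalizing k with
  | zero =>
    refine ⟨{List.replicate k leaf}, by simp [g], ?_⟩
    intro l
    rw [Finset.mem_singleton, List.eq_replicate_iff]
    constructor
    · rintro ⟨h1, h2⟩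
      refine ⟨h1, ?_⟩
      rw [List.sum_eq_zero_iff]
      intro x hx
      obtain ⟨t, ht, rfl⟩ := List.mem_map.1 hx
      rw [h2 t ht]; rfl
    · rintro ⟨h1, h2⟩
      refine ⟨h1, ?_⟩
      rw [List.sum_eq_zero_iff] at h2
      intro t ht
      have := h2 _ (List.mem_map_of_mem (f := size) ht)
      cases t with
      | leaf => rfl
      | node => simp [size] at this
  | succ n ihn =>
    induction k with
    | zero =>
      refine ⟨∅, by simp [g], ?_⟩
      intro l
      simp only [Finset.notMem_empty, List.length_eq_zero_iff, false_iff]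
      rintro ⟨rfl, h⟩
      simp at h
    | succ k ihk =>
      obtain ⟨A, hA, hA'⟩ := ihk
      obtain ⟨B, hB, hB'⟩ := ihn (k + 4)
      let f : List QTree → List QTree := fun l => match l with
        | a :: b :: c :: d :: r => node a b c d :: r
        | _ => []
      refine ⟨A.image (fun l => leaf :: l) ∪ B.image f, ?_, ?_⟩
      · rw [Finset.card_union_of_disjoint, Finset.card_image_of_injOn, Finset.card_image_of_injOn,
          hA, hB, g]
        · intro l hl l' hl' h
          have h1 := ((hB' l).1 hl).1
          have h2 := ((hB' l').1 hl').1
          rcases l with _ | ⟨a, _ | ⟨b, _ | ⟨c, _ | ⟨d, r⟩⟩⟩⟩ <;> simp at h1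
          rcases l' with _ | ⟨a', _ | ⟨b', _ | ⟨c', _ | ⟨d', r'⟩⟩⟩⟩ <;> simp at h2
          simp [f] at h
          simp [h]
        · intro l _ l' _ h
          simpa using h
        · rw [Finset.disjoint_left]
          intro x hx hy
          obtain ⟨l, hl, rfl⟩ := Finset.mem_image.1 hx
          obtain ⟨l', hl', h⟩ := Finset.mem_image.1 hy
          rcases l' with _ | ⟨a', _ | ⟨b', _ | ⟨c', _ | ⟨d', r'⟩⟩⟩⟩ <;> simp [f] at h
      · intro l
        simp only [Finset.mem_union, Finset.mem_image, hA', hB']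
        constructor
        · rintro (⟨l, ⟨h1, h2⟩, rfl⟩ | ⟨l, ⟨h1, h2⟩, rfl⟩)
          · simp [h1, h2, size]
          · rcases l with _ | ⟨a, _ | ⟨b, _ | ⟨c, _ | ⟨d, r⟩⟩⟩⟩ <;> simp at h1
            simp at h2
            simp [f, h1, size]
            omega
        · rintro ⟨h1, h2⟩
          rcases l with _ | ⟨t, r⟩
          · simp at h1
          · simp at h1 h2
            cases t with
            | leaf => 
              left
              exact ⟨r, ⟨h1, by simpa [size] using h2⟩, rfl⟩
            | node a b c d =>
              right
              refine ⟨a :: b :: c :: d :: r, ⟨by simp [h1], ?_⟩, rfl⟩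
              simp [size] at h2 ⊢
              omega

theorem trees_ncard (n : ℕ) : {t : QTree | t.size = n}.ncard = g n 1 := by
  classical
  obtain ⟨S, hS, hS'⟩ := forests n 1
  rw [← hS, ← Set.ncard_coe_finset]
  have : (S : Set (List QTree)) = (fun t => [t]) '' {t : QTree | t.size = n} := by
    ext l
    simp only [Finset.mem_coe, hS', Set.mem_image, Set.mem_ofPred_eq, List.length_eq_one_iff]
    constructor
    · rintro ⟨⟨t, rfl⟩, h⟩
      exact ⟨t, by simpa using h, rfl⟩
    · rintro ⟨t, h, rfl⟩
      exact ⟨⟨t, rfl⟩, by simpa using h⟩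
  rw [this, Set.ncard_image_of_injective]
  intro a b h
  simpa using h

end QTree

/-- symmetric crossing of chords -/
def XX (p q : ℕ × ℕ) : Prop :=
  (p.1 < q.1 ∧ q.1 < p.2 ∧ p.2 < q.2) ∨ (q.1 < p.1 ∧ p.1 < q.2 ∧ q.2 < p.2)

structure VV (S : Set ℕ) (C : Finset (ℕ × ℕ)) : Prop where
  mem1 : ∀ p ∈ C, p.1 ∈ S
  mem2 : ∀ p ∈ C, p.2 ∈ S
  lt : ∀ p ∈ C, p.1 < p.2
  cover : ∀ x ∈ S, ∃ p ∈ C, x = p.1 ∨ x = p.2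
  uniq : ∀ p ∈ C, ∀ q ∈ C, ∀ x, (x = p.1 ∨ x = p.2) → (x = q.1 ∨ x = q.2) → p = q
  ex : ∀ p ∈ C, ∃ q ∈ C, XX p q
  un : ∀ p ∈ C, ∀ q ∈ C, ∀ r ∈ C, XX p q → XX p r → q = r
  par : ∀ p ∈ C, p.1 % 2 = p.2 % 2
  opp : ∀ p ∈ C, ∀ q ∈ C, XX p q → p.1 % 2 ≠ q.1 % 2

theorem XX.symm {p q : ℕ × ℕ} (h : XX p q) : XX q p := by
  unfold XX at *; omega

theorem VV.glue {S : Set ℕ} {A B : Finset (ℕ × ℕ)} {u v : ℕ} (hB : VV S B)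
    (hA : VV (Set.Ico u v) A) (hd : ∀ x ∈ S, x < u ∨ v ≤ x) : VV (S ∪ Set.Ico u v) (B ∪ A) := by
  have hX : ∀ p ∈ B, ∀ q ∈ A, ¬ XX p q := by
    intro p hp q hq h
    have h1 := hd _ (hB.mem1 p hp)
    have h2 := hd _ (hB.mem2 p hp)
    have h3 := hA.mem1 q hq
    have h4 := hA.mem2 q hq
    have h5 := hB.lt p hp
    simp only [Set.mem_Ico] at h3 h4
    unfold XX at h
    omega
  have hX' : ∀ p ∈ B, ∀ q ∈ A, ¬ XX q p := fun p hp q hq h => hX p hp q hq h.symm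
  have hN : ∀ p ∈ B, ∀ q ∈ A, ∀ x, (x = p.1 ∨ x = p.2) → (x = q.1 ∨ x = q.2) → False := by
    intro p hp q hq x
    have h1 := hd _ (hB.mem1 p hp)
    have h2 := hd _ (hB.mem2 p hp)
    have h3 := hA.mem1 q hq
    have h4 := hA.mem2 q hq
    simp only [Set.mem_Ico] at h3 h4
    omega
  obtain ⟨a1, a2, a3, a4, a5, a6, a7, a8, a9⟩ := hA
  obtain ⟨b1, b2, b3, b4, b5, b6, b7, b8, b9⟩ := hB
  constructor
  · intro p hp
    rcases Finset.mem_union.1 hp with hp | hp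
    exacts [Or.inl (b1 p hp), Or.inr (a1 p hp)]
  · intro p hp
    rcases Finset.mem_union.1 hp with hp | hp
    exacts [Or.inl (b2 p hp), Or.inr (a2 p hp)]
  · intro p hp
    rcases Finset.mem_union.1 hp with hp | hp
    exacts [b3 p hp, a3 p hp]
  · rintro x (hx | hx)
    · obtain ⟨p, hp, h⟩ := b4 x hx
      exact ⟨p, Finset.mem_union_left _ hp, h⟩
    · obtain ⟨p, hp, h⟩ := a4 x hx
      exact ⟨p, Finset.mem_union_right _ hp, h⟩
  · intro p hp q hq x h1 h2
    rcases Finset.mem_union.1 hp with hp | hp <;> rcases Finset.mem_union.1 hq with hq | hq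
    · exact b5 p hp q hq x h1 h2
    · exact (hN p hp q hq x h1 h2).elim
    · exact (hN q hq p hp x h2 h1).elim
    · exact a5 p hp q hq x h1 h2
  · intro p hp
    rcases Finset.mem_union.1 hp with hp | hp
    · obtain ⟨q, hq, h⟩ := b6 p hp
      exact ⟨q, Finset.mem_union_left _ hq, h⟩
    · obtain ⟨q, hq, h⟩ := a6 p hp
      exact ⟨q, Finset.mem_union_right _ hq, h⟩
  · intro p hp q hq r hr h1 h2
    rcases Finset.mem_union.1 hp with hp | hp <;> rcases Finset.mem_union.1 hq with hq | hq <;>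
      rcases Finset.mem_union.1 hr with hr | hr
    · exact b7 p hp q hq r hr h1 h2
    · exact (hX p hp r hr h2).elim
    · exact (hX p hp q hq h1).elim
    · exact (hX p hp q hq h1).elim
    · exact (hX' q hq p hp h1).elim
    · exact (hX' q hq p hp h1).elim
    · exact (hX' r hr p hp h2).elim
    · exact a7 p hp q hq r hr h1 h2
  · intro p hp
    rcases Finset.mem_union.1 hp with hp | hp
    exacts [b8 p hp, a8 p hp]
  · intro p hp q hq h1
    rcases Finset.mem_union.1 hp with hp | hp <;> rcases Finset.mem_union.1 hq with hq | hq
    · exact b9 p hp q hq h1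
    · exact (hX p hp q hq h1).elim
    · exact (hX' q hq p hp h1).elim
    · exact a9 p hp q hq h1

/-- restriction of a chord set to an interval -/
def res (C : Finset (ℕ × ℕ)) (u v : ℕ) : Finset (ℕ × ℕ) :=
  C.filter (fun p => u ≤ p.1 ∧ p.2 < v)

theorem VV.restrict {S : Set ℕ} {C : Finset (ℕ × ℕ)} {u v : ℕ} (hC : VV S C)
    (hs : ∀ x, u ≤ x → x < v → x ∈ S)
    (hcl : ∀ p ∈ C, (u ≤ p.1 ∧ p.1 < v) ↔ (u ≤ p.2 ∧ p.2 < v)) :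
    VV (Set.Ico u v) (res C u v) := by
  obtain ⟨b1, b2, b3, b4, b5, b6, b7, b8, b9⟩ := hC
  have hm : ∀ p, p ∈ res C u v ↔ p ∈ C ∧ u ≤ p.1 ∧ p.2 < v := by simp [res]
  constructor
  · intro p hp
    have := b3 p ((hm p).1 hp).1
    have := (hm p).1 hp
    simp only [Set.mem_Ico]; omega
  · intro p hp
    have := b3 p ((hm p).1 hp).1
    have := (hm p).1 hp
    simp only [Set.mem_Ico]; omega
  · intro p hp
    exact b3 p ((hm p).1 hp).1
  · intro x hx
    obtain ⟨p, hp, h⟩ := b4 x (hs x hx.1 hx.2)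
    have h2 := hcl p hp
    have h3 := b3 p hp
    simp only [Set.mem_Ico] at hx
    refine ⟨p, (hm p).2 ⟨hp, ?_⟩, h⟩
    rcases h with h | h <;> subst h <;> omega
  · intro p hp q hq
    exact b5 p ((hm p).1 hp).1 q ((hm q).1 hq).1
  · intro p hp
    obtain ⟨q, hq, h⟩ := b6 p ((hm p).1 hp).1
    refine ⟨q, (hm q).2 ⟨hq, ?_⟩, h⟩
    have h2 := hcl q hq
    have h3 := (hm p).1 hp
    have h4 := b3 p h3.1
    have h5 := b3 q hq
    unfold XX at h
    omega
  · intro p hp q hq r hr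
    exact b7 p ((hm p).1 hp).1 q ((hm q).1 hq).1 r ((hm r).1 hr).1
  · intro p hp
    exact b8 p ((hm p).1 hp).1
  · intro p hp q hq
    exact b9 p ((hm p).1 hp).1 q ((hm q).1 hq).1

theorem VV.base {a b c d : ℕ} (h1 : a < b) (h2 : b < c) (h3 : c < d) (e1 : a % 2 = c % 2)
    (e2 : b % 2 = d % 2) (e3 : a % 2 ≠ b % 2) : VV {a, b, c, d} {(a, c), (b, d)} := by
  constructor <;> simp [XX] <;> omega

theorem QTree.valid (t : QTree) (o : ℕ) : VV (Set.Ico o (o + 4 * t.size)) (t.chords o) := by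
  induction t generalizing o with
  | leaf => constructor <;> simp [QTree.size, QTree.chords]
  | node a b c d iha ihb ihc ihd =>
    have h0 := VV.base (a := o) (b := o + 4 * a.size + 1) (c := o + 4 * a.size + 4 * b.size + 2)
      (d := o + 4 * a.size + 4 * b.size + 4 * c.size + 3) (by omega) (by omega) (by omega)
      (by omega) (by omega) (by omega)
    have h1 := h0.glue (iha (o + 1)) (by simp; omega)
    have h2 := h1.glue (ihb (o + 4 * a.size + 2)) (by simp; omega)
    have h3 := h2.glue (ihc (o + 4 * a.size + 4 * b.size + 3)) (by simp; omega)
    have h4 := h3.glue (ihd (o + 4 * a.size + 4 * b.size + 4 * c.size + 4)) (by simp; omega)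
    rw [QTree.chords]
    convert h4 using 1
    ext x
    simp [QTree.size]
    omega

theorem VV.exists_tree (N : ℕ) : ∀ (lo : ℕ) (C : Finset (ℕ × ℕ)),
    VV (Set.Ico lo (lo + N)) C → ∃ t : QTree, N = 4 * t.size ∧ C = t.chords lo := by
  induction N using Nat.strong_induction_on with
  | _ N ih =>
  intro lo C hC
  rcases Nat.eq_zero_or_pos N with rfl | hN
  · refine ⟨QTree.leaf, rfl, ?_⟩
    rw [QTree.chords, Finset.eq_empty_iff_forall_notMem]
    intro p hp
    simpa using hC.mem1 p hp
  obtain ⟨⟨a, c⟩, hp, hx⟩ := hC.cover lo (by simp [hN])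
  have hm1 := hC.mem1 _ hp
  have hm2 := hC.mem2 _ hp
  have hl := hC.lt _ hp
  obtain ⟨⟨b, d⟩, hq, hX⟩ := hC.ex _ hp
  have hq1 := hC.mem1 _ hq
  have hq2 := hC.mem2 _ hq
  have hXX := hX
  simp only [XX, Set.mem_Ico] at hXX hm1 hm2 hl hq1 hq2 hx
  have e0 : a = lo := by omega
  subst e0
  have hab : a < b := by omega
  have hbc : b < c := by omega
  have hcd : c < d := by omega
  have key : ∀ r ∈ C, r = (a, c) ∨ r = (b, d) ∨ (a < r.1 ∧ r.2 < b) ∨ (b < r.1 ∧ r.2 < c) ∨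
      (c < r.1 ∧ r.2 < d) ∨ (d < r.1 ∧ r.2 < a + N) := by
    intro r hr
    by_cases r1 : r = (a, c)
    · exact Or.inl r1
    by_cases r2 : r = (b, d)
    · exact Or.inr (Or.inl r2)
    right; right
    have n1 : ¬ XX (a, c) r := fun h => r2 (hC.un _ hp _ hr _ hq h hX)
    have n2 : ¬ XX (b, d) r := fun h => r1 (hC.un _ hq _ hr _ hp h hX.symm)
    have l := hC.lt _ hr
    have m1 := hC.mem1 _ hr
    have m2 := hC.mem2 _ hr
    have ua : ¬ (a = r.1 ∨ a = r.2) := fun h => r1 (hC.uniq _ hr _ hp a h (Or.inl rfl))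
    have uc : ¬ (c = r.1 ∨ c = r.2) := fun h => r1 (hC.uniq _ hr _ hp c h (Or.inr rfl))
    have ub : ¬ (b = r.1 ∨ b = r.2) := fun h => r2 (hC.uniq _ hr _ hq b h (Or.inl rfl))
    have ud : ¬ (d = r.1 ∨ d = r.2) := fun h => r2 (hC.uniq _ hr _ hq d h (Or.inr rfl))
    simp only [XX, Set.mem_Ico] at n1 n2 m1 m2
    omega
  have hlt := hC.lt
  have R : ∀ u v, (u = a + 1 ∧ v = b ∨ u = b + 1 ∧ v = c ∨ u = c + 1 ∧ v = d ∨
      u = d + 1 ∧ v = a + N) → VV (Set.Ico u v) (res C u v) := by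
    intro u v huv
    apply hC.restrict
    · intro x h1 h2
      simp only [Set.mem_Ico]; omega
    · intro r hr
      have k := key r hr
      have l := hlt r hr
      rcases k with rfl | rfl | k
      · simp only; omega
      · simp only; omega
      · omega
  have Ra := R (a + 1) b (by omega)
  have Rb := R (b + 1) c (by omega)
  have Rc := R (c + 1) d (by omega)
  have Rd := R (d + 1) (a + N) (by omega)
  rw [show b = a + 1 + (b - a - 1) by omega] at Ra
  rw [show c = b + 1 + (c - b - 1) by omega] at Rb
  rw [show d = c + 1 + (d - c - 1) by omega] at Rc
  rw [show a + N = d + 1 + (a + N - d - 1) by omega] at Rd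
  obtain ⟨ta, sa, ca⟩ := ih _ (by omega) _ _ Ra
  obtain ⟨tb, sb, cb⟩ := ih _ (by omega) _ _ Rb
  obtain ⟨tc, sc, cc⟩ := ih _ (by omega) _ _ Rc
  obtain ⟨td, sd, cd⟩ := ih _ (by omega) _ _ Rd
  refine ⟨QTree.node ta tb tc td, by rw [QTree.size]; omega, ?_⟩
  rw [QTree.chords]
  rw [show a + 4 * ta.size + 2 = b + 1 by omega,
    show a + 4 * ta.size + 4 * tb.size + 3 = c + 1 by omega,
    show a + 4 * ta.size + 4 * tb.size + 4 * tc.size + 4 = d + 1 by omega,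
    show a + 4 * ta.size + 4 * tb.size + 2 = c by omega,
    show a + 4 * ta.size + 4 * tb.size + 4 * tc.size + 3 = d by omega,
    show a + 4 * ta.size + 1 = b by omega, ← ca, ← cb, ← cc, ← cd]
  ext r
  simp only [res, Finset.mem_union, Finset.mem_insert, Finset.mem_singleton, Finset.mem_filter]
  constructor
  · intro hr
    have k := key r hr
    have l := hlt r hr
    rcases k with k | k | k | k | k | k
    · simp [k]
    · simp [k]
    · have : a + 1 ≤ r.1 ∧ r.2 < a + 1 + (b - a - 1) := by omega
      exact Or.inl (Or.inl (Or.inl (Or.inr ⟨hr, this⟩)))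
    · have : b + 1 ≤ r.1 ∧ r.2 < b + 1 + (c - b - 1) := by omega
      exact Or.inl (Or.inl (Or.inr ⟨hr, this⟩))
    · have : c + 1 ≤ r.1 ∧ r.2 < c + 1 + (d - c - 1) := by omega
      exact Or.inl (Or.inr ⟨hr, this⟩)
    · have : d + 1 ≤ r.1 ∧ r.2 < d + 1 + (a + N - d - 1) := by omega
      exact Or.inr ⟨hr, this⟩
  · rintro (((((rfl | rfl) | h) | h) | h) | h)
    exacts [hp, hq, h.1, h.1, h.1, h.1]

theorem QTree.chords_inj (t s : QTree) (o : ℕ) (hs : t.size = s.size)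
    (h : t.chords o = s.chords o) : t = s := by
  induction t generalizing s o with
  | leaf =>
    cases s with
    | leaf => rfl
    | node => simp [QTree.size] at hs
  | node a b c d iha ihb ihc ihd =>
    cases s with
    | leaf => simp [QTree.size] at hs
    | node a' b' c' d' =>
      have V := (QTree.node a b c d).valid o
      have hp : (o, o + 4 * a.size + 4 * b.size + 2) ∈ (QTree.node a b c d).chords o := by
        simp [QTree.chords]
      have hq : (o + 4 * a.size + 1, o + 4 * a.size + 4 * b.size + 4 * c.size + 3) ∈
          (QTree.node a b c d).chords o := by
        simp [QTree.chords]
      have hp' : (o, o + 4 * a'.size + 4 * b'.size + 2) ∈ (QTree.node a b c d).chords o := by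
        rw [h]; simp [QTree.chords]
      have hq' : (o + 4 * a'.size + 1, o + 4 * a'.size + 4 * b'.size + 4 * c'.size + 3) ∈
          (QTree.node a b c d).chords o := by
        rw [h]; simp [QTree.chords]
      have e1 := V.uniq _ hp _ hp' o (Or.inl rfl) (Or.inl rfl)
      have e2 := V.un _ hp _ hq _ hq' (by simp only [XX]; omega)
        (by rw [e1]; simp only [XX]; omega)
      simp only [Prod.mk.injEq] at e1 e2
      simp only [QTree.size] at hs
      have sa : a.size = a'.size := by omega
      have sb : b.size = b'.size := by omega
      have sc : c.size = c'.size := by omega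
      have sd : d.size = d'.size := by omega
      have M : ∀ (a b c d : QTree) (r : ℕ × ℕ),
          (r ∈ a.chords (o + 1) ↔ r ∈ (QTree.node a b c d).chords o ∧ o + 1 ≤ r.1 ∧
            r.2 < o + 4 * a.size + 1) ∧
          (r ∈ b.chords (o + 4 * a.size + 2) ↔ r ∈ (QTree.node a b c d).chords o ∧
            o + 4 * a.size + 2 ≤ r.1 ∧ r.2 < o + 4 * a.size + 4 * b.size + 2) ∧
          (r ∈ c.chords (o + 4 * a.size + 4 * b.size + 3) ↔ r ∈ (QTree.node a b c d).chords o ∧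
            o + 4 * a.size + 4 * b.size + 3 ≤ r.1 ∧
            r.2 < o + 4 * a.size + 4 * b.size + 4 * c.size + 3) ∧
          (r ∈ d.chords (o + 4 * a.size + 4 * b.size + 4 * c.size + 4) ↔
            r ∈ (QTree.node a b c d).chords o ∧
            o + 4 * a.size + 4 * b.size + 4 * c.size + 4 ≤ r.1) := by
        intro a b c d r
        have B : ∀ (t : QTree) (o : ℕ), r ∈ t.chords o → o ≤ r.1 ∧ r.1 < r.2 ∧
            r.2 < o + 4 * t.size := by
          intro t o hr
          have V := t.valid o
          exact ⟨(V.mem1 _ hr).1, V.lt _ hr, (V.mem2 _ hr).2⟩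
        have Ba := B a (o + 1)
        have Bb := B b (o + 4 * a.size + 2)
        have Bc := B c (o + 4 * a.size + 4 * b.size + 3)
        have Bd := B d (o + 4 * a.size + 4 * b.size + 4 * c.size + 4)
        have hmem : r ∈ (QTree.node a b c d).chords o ↔
            (((((r.1 = o ∧ r.2 = o + 4 * a.size + 4 * b.size + 2) ∨
            (r.1 = o + 4 * a.size + 1 ∧ r.2 = o + 4 * a.size + 4 * b.size + 4 * c.size + 3)) ∨
            r ∈ a.chords (o + 1)) ∨ r ∈ b.chords (o + 4 * a.size + 2)) ∨
            r ∈ c.chords (o + 4 * a.size + 4 * b.size + 3)) ∨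
            r ∈ d.chords (o + 4 * a.size + 4 * b.size + 4 * c.size + 4) := by
          rw [QTree.chords]
          simp only [Finset.mem_union, Finset.mem_insert, Finset.mem_singleton, Prod.ext_iff]
        rw [hmem]
        refine ⟨?_, ?_, ?_, ?_⟩ <;> constructor <;> intro hh <;> first | omega | grind
      have M1 := M a b c d
      have M2 := M a' b' c' d'
      rw [← h, ← sa, ← sb, ← sc] at M2
      rw [iha a' _ sa (Finset.ext fun r => (M1 r).1.trans (M2 r).1.symm),
        ihb b' _ sb (Finset.ext fun r => (M1 r).2.1.trans (M2 r).2.1.symm),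
        ihc c' _ sc (Finset.ext fun r => (M1 r).2.2.1.trans (M2 r).2.2.1.symm),
        ihd d' _ sd (Finset.ext fun r => (M1 r).2.2.2.trans (M2 r).2.2.2.symm)]


/-- the underlying pair of natural numbers -/
def vv {m : ℕ} (p : Fin m × Fin m) : ℕ × ℕ := (p.1.val, p.2.val)

theorem vv_inj {m : ℕ} {p q : Fin m × Fin m} (h : vv p = vv q) : p = q := by
  simp only [vv, Prod.mk.injEq] at h
  exact Prod.ext (Fin.ext h.1) (Fin.ext h.2)

theorem cc_iff {m : ℕ} {p q : Fin m × Fin m} (hp : p.1 < p.2) (hq : q.1 < q.2)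
    (h : p = q ∨ (p.1 ≠ q.1 ∧ p.1 ≠ q.2 ∧ p.2 ≠ q.1 ∧ p.2 ≠ q.2)) :
    ChordCrosses p q ↔ XX (vv p) (vv q) := by
  unfold ChordCrosses XX vv Xor' Xor
  rcases h with rfl | h
  · simp
  · simp only [Fin.lt_def, ne_eq, Fin.ext_iff] at *
    omega

/-- The predicate in the statement. -/
def BB (n : ℕ) (R I : Finset (Fin (4 * n) × Fin (4 * n))) : Prop :=
      (∀ p ∈ R, p.1 < p.2 ∧ p.1.val % 2 = 1 ∧ p.2.val % 2 = 1) ∧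
      (∀ p ∈ I, p.1 < p.2 ∧ p.1.val % 2 = 0 ∧ p.2.val % 2 = 0) ∧
      (∀ x : Fin (4 * n), x.val % 2 = 1 → ∃! p, p ∈ R ∧ (x = p.1 ∨ x = p.2)) ∧
      (∀ x : Fin (4 * n), x.val % 2 = 0 → ∃! p, p ∈ I ∧ (x = p.1 ∨ x = p.2)) ∧
      (∀ p ∈ R, ∀ q ∈ R, ¬ ChordCrosses p q) ∧
      (∀ p ∈ I, ∀ q ∈ I, ¬ ChordCrosses p q) ∧
      (∀ p ∈ R, ∃! q, q ∈ I ∧ ChordCrosses p q) ∧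
      (∀ q ∈ I, ∃! p, p ∈ R ∧ ChordCrosses p q)

/-- the chords of a given parity -/
def FF (n : ℕ) (C : Finset (ℕ × ℕ)) (e : ℕ) : Finset (Fin (4 * n) × Fin (4 * n)) :=
  Finset.univ.filter (fun p => vv p ∈ C ∧ p.1.val % 2 = e)

theorem mem_FF {n : ℕ} {C : Finset (ℕ × ℕ)} {e : ℕ} {p : Fin (4 * n) × Fin (4 * n)} :
    p ∈ FF n C e ↔ vv p ∈ C ∧ p.1.val % 2 = e := by
  simp [FF]

theorem exists_vv {n : ℕ} {C : Finset (ℕ × ℕ)} (V : VV (Set.Ico 0 (4 * n)) C) {r : ℕ × ℕ}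
    (hr : r ∈ C) : ∃ p : Fin (4 * n) × Fin (4 * n), vv p = r :=
  ⟨(⟨r.1, (V.mem1 r hr).2⟩, ⟨r.2, (V.mem2 r hr).2⟩), rfl⟩

theorem cc_of_VV {n : ℕ} {C : Finset (ℕ × ℕ)} (V : VV (Set.Ico 0 (4 * n)) C)
    {p q : Fin (4 * n) × Fin (4 * n)} (hp : vv p ∈ C) (hq : vv q ∈ C) :
    ChordCrosses p q ↔ XX (vv p) (vv q) := by
  apply cc_iff (V.lt _ hp) (V.lt _ hq)
  by_cases h : p = q
  · exact Or.inl h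
  right
  have u := fun x h1 h2 => h (vv_inj (V.uniq _ hp _ hq x h1 h2))
  refine ⟨fun e => u p.1 (Or.inl rfl) (Or.inl ?_), fun e => u p.1 (Or.inl rfl) (Or.inr ?_),
    fun e => u p.2 (Or.inr rfl) (Or.inl ?_), fun e => u p.2 (Or.inr rfl) (Or.inr ?_)⟩ <;>
  · rw [e]; rfl

theorem BB_of_VV {n : ℕ} {C : Finset (ℕ × ℕ)} (V : VV (Set.Ico 0 (4 * n)) C) :
    BB n (FF n C 1) (FF n C 0) := by
  have A : ∀ e, ∀ p ∈ FF n C e, p.1 < p.2 ∧ p.1.val % 2 = e ∧ p.2.val % 2 = e := by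
    intro e p hp
    obtain ⟨h1, h2⟩ := mem_FF.1 hp
    have h3 : p.1.val % 2 = p.2.val % 2 := V.par _ h1
    exact ⟨V.lt _ h1, h2, h3 ▸ h2⟩
  have B : ∀ e, ∀ x : Fin (4 * n), x.val % 2 = e →
      ∃! p, p ∈ FF n C e ∧ (x = p.1 ∨ x = p.2) := by
    intro e x hx
    obtain ⟨r, hr, hxr⟩ := V.cover x.val ⟨Nat.zero_le _, x.2⟩
    obtain ⟨p, rfl⟩ := exists_vv V hr
    have hpar : p.1.val % 2 = p.2.val % 2 := V.par _ hr
    refine ⟨p, ⟨mem_FF.2 ⟨hr, ?_⟩, ?_⟩, ?_⟩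
    · simp only [vv] at hxr
      rcases hxr with h | h <;> rw [h] at hx <;> omega
    · simpa only [vv, Fin.ext_iff] using hxr
    · rintro q ⟨hq, hxq⟩
      refine vv_inj (V.uniq _ (mem_FF.1 hq).1 _ hr x ?_ hxr)
      simpa only [vv, Fin.ext_iff] using hxq
  have D : ∀ e, ∀ p ∈ FF n C e, ∀ q ∈ FF n C e, ¬ ChordCrosses p q := by
    intro e p hp q hq h
    obtain ⟨h1, h2⟩ := mem_FF.1 hp
    obtain ⟨h3, h4⟩ := mem_FF.1 hq
    exact V.opp _ h1 _ h3 ((cc_of_VV V h1 h3).1 h) (h2.trans h4.symm)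
  have E : ∀ e f, e + f = 1 → ∀ p ∈ FF n C e, ∃! q, q ∈ FF n C f ∧ XX (vv p) (vv q) := by
    intro e f hef p hp
    obtain ⟨h1, h2⟩ := mem_FF.1 hp
    obtain ⟨r, hr, hX⟩ := V.ex _ h1
    obtain ⟨q, rfl⟩ := exists_vv V hr
    have ho : p.1.val % 2 ≠ q.1.val % 2 := V.opp _ h1 _ hr hX
    refine ⟨q, ⟨mem_FF.2 ⟨hr, by omega⟩, hX⟩, ?_⟩
    rintro q' ⟨hq', hX'⟩
    exact vv_inj (V.un _ h1 _ (mem_FF.1 hq').1 _ hr hX' hX)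
  refine ⟨A 1, A 0, B 1, B 0, D 1, D 0, ?_, ?_⟩
  · intro p hp
    obtain ⟨q, ⟨h1, h2⟩, h3⟩ := E 1 0 rfl p hp
    refine ⟨q, ⟨h1, (cc_of_VV V (mem_FF.1 hp).1 (mem_FF.1 h1).1).2 h2⟩, ?_⟩
    rintro q' ⟨h4, h5⟩
    exact h3 q' ⟨h4, (cc_of_VV V (mem_FF.1 hp).1 (mem_FF.1 h4).1).1 h5⟩
  · intro p hp
    obtain ⟨q, ⟨h1, h2⟩, h3⟩ := E 0 1 rfl p hp
    refine ⟨q, ⟨h1, (cc_of_VV V (mem_FF.1 h1).1 (mem_FF.1 hp).1).2 h2.symm⟩, ?_⟩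
    rintro q' ⟨h4, h5⟩
    exact h3 q' ⟨h4, ((cc_of_VV V (mem_FF.1 h4).1 (mem_FF.1 hp).1).1 h5).symm⟩

theorem VV_of_BB {n : ℕ} {R I : Finset (Fin (4 * n) × Fin (4 * n))} (h : BB n R I) :
    VV (Set.Ico 0 (4 * n)) ((R ∪ I).image vv) := by
  obtain ⟨r1, i1, r2, i2, r3, i3, r4, i4⟩ := h
  have lt : ∀ p ∈ R ∪ I, p.1 < p.2 := by
    intro p hp
    rcases Finset.mem_union.1 hp with hp | hp
    exacts [(r1 p hp).1, (i1 p hp).1]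
  have uniq : ∀ p ∈ R ∪ I, ∀ q ∈ R ∪ I, ∀ x, (x = p.1 ∨ x = p.2) → (x = q.1 ∨ x = q.2) →
      p = q := by
    intro p hp q hq x h1 h2
    rcases Finset.mem_union.1 hp with hp | hp <;> rcases Finset.mem_union.1 hq with hq | hq
    · have hx : x.val % 2 = 1 := by
        rcases h1 with rfl | rfl
        exacts [(r1 p hp).2.1, (r1 p hp).2.2]
      exact (r2 x hx).unique ⟨hp, h1⟩ ⟨hq, h2⟩
    · exfalso
      have := r1 p hp
      have := i1 q hq
      simp only [Fin.ext_iff] at h1 h2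
      omega
    · exfalso
      have := i1 p hp
      have := r1 q hq
      simp only [Fin.ext_iff] at h1 h2
      omega
    · have hx : x.val % 2 = 0 := by
        rcases h1 with rfl | rfl
        exacts [(i1 p hp).2.1, (i1 p hp).2.2]
      exact (i2 x hx).unique ⟨hp, h1⟩ ⟨hq, h2⟩
  have cc : ∀ p ∈ R ∪ I, ∀ q ∈ R ∪ I, (ChordCrosses p q ↔ XX (vv p) (vv q)) := by
    intro p hp q hq
    apply cc_iff (lt p hp) (lt q hq)
    by_cases h : p = q
    · exact Or.inl h
    right
    have u := fun x h1 h2 => h (uniq _ hp _ hq x h1 h2)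
    exact ⟨fun e => u p.1 (Or.inl rfl) (Or.inl e), fun e => u p.1 (Or.inl rfl) (Or.inr e),
      fun e => u p.2 (Or.inr rfl) (Or.inl e), fun e => u p.2 (Or.inr rfl) (Or.inr e)⟩
  have mR : ∀ p ∈ R, p ∈ R ∪ I := fun p hp => Finset.mem_union_left _ hp
  have mI : ∀ p ∈ I, p ∈ R ∪ I := fun p hp => Finset.mem_union_right _ hp
  have noR : ∀ p ∈ R, ∀ q ∈ R ∪ I, XX (vv p) (vv q) → q ∈ I ∧ ChordCrosses p q := by
    intro p hp q hq hX
    have hc := (cc p (mR p hp) q hq).2 hX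
    rcases Finset.mem_union.1 hq with hq | hq
    · exact (r3 p hp q hq hc).elim
    · exact ⟨hq, hc⟩
  have noI : ∀ p ∈ I, ∀ q ∈ R ∪ I, XX (vv p) (vv q) → q ∈ R ∧ ChordCrosses q p := by
    intro p hp q hq hX
    rcases Finset.mem_union.1 hq with hq' | hq'
    · exact ⟨hq', (cc q hq p (mI p hp)).2 hX.symm⟩
    · exact (i3 p hp q hq' ((cc p (mI p hp) q hq).2 hX)).elim
  constructor
  · intro p hp
    obtain ⟨p, hp0, rfl⟩ := Finset.mem_image.1 hp; replace hp := hp0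
    exact ⟨Nat.zero_le _, p.1.2⟩
  · intro p hp
    obtain ⟨p, hp0, rfl⟩ := Finset.mem_image.1 hp; replace hp := hp0
    exact ⟨Nat.zero_le _, p.2.2⟩
  · intro p hp
    obtain ⟨p, hp0, rfl⟩ := Finset.mem_image.1 hp; replace hp := hp0
    exact lt p hp
  · intro x hx
    rcases Nat.mod_two_eq_zero_or_one x with h | h
    · obtain ⟨p, ⟨hp, hxp⟩, -⟩ := i2 ⟨x, hx.2⟩ h
      refine ⟨vv p, Finset.mem_image_of_mem _ (mI p hp), ?_⟩
      simpa only [vv, Fin.ext_iff] using hxp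
    · obtain ⟨p, ⟨hp, hxp⟩, -⟩ := r2 ⟨x, hx.2⟩ h
      refine ⟨vv p, Finset.mem_image_of_mem _ (mR p hp), ?_⟩
      simpa only [vv, Fin.ext_iff] using hxp
  · intro p hp q hq x h1 h2
    obtain ⟨p, hp0, rfl⟩ := Finset.mem_image.1 hp; replace hp := hp0
    obtain ⟨q, hq0, rfl⟩ := Finset.mem_image.1 hq; replace hq := hq0
    have hx : x < 4 * n := by
      rcases h1 with rfl | rfl
      exacts [p.1.2, p.2.2]
    rw [uniq p hp q hq ⟨x, hx⟩ (by simpa only [vv, Fin.ext_iff] using h1)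
      (by simpa only [vv, Fin.ext_iff] using h2)]
  · intro p hp
    obtain ⟨p, hp0, rfl⟩ := Finset.mem_image.1 hp; replace hp := hp0
    rcases Finset.mem_union.1 hp with hp' | hp'
    · obtain ⟨q, ⟨hq, hc⟩, -⟩ := r4 p hp'
      exact ⟨vv q, Finset.mem_image_of_mem _ (mI q hq), (cc p hp q (mI q hq)).1 hc⟩
    · obtain ⟨q, ⟨hq, hc⟩, -⟩ := i4 p hp'
      exact ⟨vv q, Finset.mem_image_of_mem _ (mR q hq), ((cc q (mR q hq) p hp).1 hc).symm⟩
  · intro p hp q hq r hr h1 h2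
    obtain ⟨p, hp0, rfl⟩ := Finset.mem_image.1 hp; replace hp := hp0
    obtain ⟨q, hq0, rfl⟩ := Finset.mem_image.1 hq; replace hq := hq0
    obtain ⟨r, hr0, rfl⟩ := Finset.mem_image.1 hr; replace hr := hr0
    congr 1
    rcases Finset.mem_union.1 hp with hp | hp
    · exact (r4 p hp).unique (noR p hp q hq h1) (noR p hp r hr h2)
    · exact (i4 p hp).unique (noI p hp q hq h1) (noI p hp r hr h2)
  · intro p hp
    obtain ⟨p, hp0, rfl⟩ := Finset.mem_image.1 hp; replace hp := hp0
    rcases Finset.mem_union.1 hp with hp | hp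
    exacts [(r1 p hp).2.1.trans (r1 p hp).2.2.symm, (i1 p hp).2.1.trans (i1 p hp).2.2.symm]
  · intro p hp q hq h
    obtain ⟨p, hp0, rfl⟩ := Finset.mem_image.1 hp; replace hp := hp0
    obtain ⟨q, hq0, rfl⟩ := Finset.mem_image.1 hq; replace hq := hq0
    simp only [vv]
    rcases Finset.mem_union.1 hp with hp | hp
    · have := r1 p hp
      have := i1 q (noR p hp q hq h).1
      omega
    · have := i1 p hp
      have := r1 q (noI p hp q hq h).1
      omega

theorem BB_eq (n : ℕ) : {RI : Finset (Fin (4 * n) × Fin (4 * n)) ×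
    Finset (Fin (4 * n) × Fin (4 * n)) | BB n RI.1 RI.2} =
    (fun t : QTree => (FF n (t.chords 0) 1, FF n (t.chords 0) 0)) '' {t | t.size = n} := by
  ext ⟨R, I⟩
  constructor
  · intro h
    have h' : BB n R I := h
    have V := VV_of_BB h'
    obtain ⟨t, ht, hC⟩ := VV.exists_tree (4 * n) 0 _ (by simpa only [Nat.zero_add] using V)
    refine ⟨t, show t.size = n by omega, ?_⟩
    have hm : ∀ p, vv p ∈ t.chords 0 ↔ p ∈ R ∨ p ∈ I := by
      intro p
      rw [← hC, Finset.mem_image]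
      constructor
      · rintro ⟨q, hq, e⟩
        rw [← vv_inj e]
        exact Finset.mem_union.1 hq
      · intro hp
        exact ⟨p, Finset.mem_union.2 hp, rfl⟩
    obtain ⟨r1, i1, -⟩ := h'
    refine Prod.ext (Finset.ext fun p => ?_) (Finset.ext fun p => ?_)
    · simp only [mem_FF, hm]
      constructor
      · rintro ⟨hp | hp, he⟩
        · exact hp
        · have := i1 p hp
          omega
      · intro hp
        exact ⟨Or.inl hp, (r1 p hp).2.1⟩
    · simp only [mem_FF, hm]
      constructor
      · rintro ⟨hp | hp, he⟩
        · have := r1 p hp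
          omega
        · exact hp
      · intro hp
        exact ⟨Or.inr hp, (i1 p hp).2.1⟩
  · rintro ⟨t, ht, e⟩
    have ht : t.size = n := ht
    have V := t.valid 0
    rw [ht, Nat.zero_add] at V
    have := BB_of_VV V
    simp only [Prod.mk.injEq] at e
    rw [e.1, e.2] at this
    exact this

theorem FF_injOn (n : ℕ) :
    Set.InjOn (fun t : QTree => (FF n (t.chords 0) 1, FF n (t.chords 0) 0)) {t | t.size = n} := by
  intro t ht s hs h
  have ht : t.size = n := ht
  have hs : s.size = n := hs
  have key : ∀ t s : QTree, t.size = n →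
      FF n (t.chords 0) 1 = FF n (s.chords 0) 1 → FF n (t.chords 0) 0 = FF n (s.chords 0) 0 →
      t.chords 0 ⊆ s.chords 0 := by
    intro t s ht h1 h0 r hr
    have V := t.valid 0
    rw [ht, Nat.zero_add] at V
    obtain ⟨p, rfl⟩ := exists_vv V hr
    rcases Nat.mod_two_eq_zero_or_one p.1.val with h | h
    · have : p ∈ FF n (t.chords 0) 0 := mem_FF.2 ⟨hr, h⟩
      rw [h0] at this
      exact (mem_FF.1 this).1
    · have : p ∈ FF n (t.chords 0) 1 := mem_FF.2 ⟨hr, h⟩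
      rw [h1] at this
      exact (mem_FF.1 this).1
  simp only [Prod.mk.injEq] at h
  exact QTree.chords_inj t s 0 (ht.trans hs.symm)
    (Finset.Subset.antisymm (key t s ht h.1 h.2) (key s t hs h.1.symm h.2.symm))

/-- The number of non-singular combinatorial `n`-basketballs, i.e. pairs `(R, I)` where
`R` is a non-crossing perfect matching of the odd points and `I` a non-crossing perfect
matching of the even points among `4n` points in cyclic order on a circle, such that
each pair of `R` crosses exactly one pair of `I` and vice versa, equals
`C(4n, n)/(3n+1)`. -/
theorem stmt16 (n : ℕ) (hn : 1 ≤ n) :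
    Set.ncard {RI : Finset (Fin (4 * n) × Fin (4 * n)) ×
        Finset (Fin (4 * n) × Fin (4 * n)) |
      (∀ p ∈ RI.1, p.1 < p.2 ∧ p.1.val % 2 = 1 ∧ p.2.val % 2 = 1) ∧
      (∀ p ∈ RI.2, p.1 < p.2 ∧ p.1.val % 2 = 0 ∧ p.2.val % 2 = 0) ∧
      (∀ x : Fin (4 * n), x.val % 2 = 1 → ∃! p, p ∈ RI.1 ∧ (x = p.1 ∨ x = p.2)) ∧
      (∀ x : Fin (4 * n), x.val % 2 = 0 → ∃! p, p ∈ RI.2 ∧ (x = p.1 ∨ x = p.2)) ∧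
      (∀ p ∈ RI.1, ∀ q ∈ RI.1, ¬ ChordCrosses p q) ∧
      (∀ p ∈ RI.2, ∀ q ∈ RI.2, ¬ ChordCrosses p q) ∧
      (∀ p ∈ RI.1, ∃! q, q ∈ RI.2 ∧ ChordCrosses p q) ∧
      (∀ q ∈ RI.2, ∃! p, p ∈ RI.1 ∧ ChordCrosses p q)} =
    Nat.choose (4 * n) n / (3 * n + 1) := by
  have h := BB_eq n
  unfold BB at h
  rw [h, Set.ncard_image_of_injOn (FF_injOn n), QTree.trees_ncard, QTree.g_one]
end
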